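/- Let P be a defining matrix of type (ee). Then gcd(M(P)) = gcd(M'(P)), where M'(P) := { |μ̂| } ∪ { |ν̂(i₀, j_{i₀})| · ∏_{i ∉ {i₀, i₁}} l_{i j_i} : 0 ≤ i₀, i₁ ≤ r, i₀ ≠ i₁, and 1 ≤ j_i ≤ n_i for all i ≠ i₁ }. -/

import Mathlib

/-- The vector `e_i` in `ℤ^{r+1}`: for `1 ≤ i ≤ r` the standard basis vector `e_i`
(occupying coordinate `i - 1`), and `e_0 := -(e_1 + ⋯ + e_r)`.
The last coordinate (index `r`) is reserved for `u`. -/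
def eVec (r : ℕ) (i : Fin (r + 1)) : Fin (r + 1) → ℤ :=
  fun k => if (i : ℕ) = 0 then (if (k : ℕ) = r then 0 else -1)
           else (if (k : ℕ) + 1 = (i : ℕ) then 1 else 0)

/-- The vector `u` in `ℤ^{r+1}` (the last standard basis vector). -/
def uVec (r : ℕ) : Fin (r + 1) → ℤ := fun k => if (k : ℕ) = r then 1 else 0

/-- The column `v_{ij} = l_{ij}·e_i + d_{ij}·u`.  Block `i` has `n i + 1` columns,
so that block sizes range over all positive integers. -/
def colV (r : ℕ) (n : Fin (r + 1) → ℕ) (l d : (i : Fin (r + 1)) → Fin (n i + 1) → ℤ)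
    (i : Fin (r + 1)) (j : Fin (n i + 1)) : Fin (r + 1) → ℤ :=
  fun k => l i j * eVec r i k + d i j * uVec r k

/-- `μ(j₀, …, j_r) = Σ_{i₀} d_{i₀ j_{i₀}} · Π_{i ≠ i₀} l_{i j_i}`. -/
def muP (r : ℕ) (n : Fin (r + 1) → ℕ) (l d : (i : Fin (r + 1)) → Fin (n i + 1) → ℤ)
    (j : (i : Fin (r + 1)) → Fin (n i + 1)) : ℤ :=
  ∑ i₀ : Fin (r + 1), d i₀ (j i₀) * ∏ i ∈ Finset.univ.erase i₀, l i (j i)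

/-- `ν(i, j, j') = l_{ij} d_{ij'} − l_{ij'} d_{ij}`. -/
def nuP (r : ℕ) (n : Fin (r + 1) → ℕ) (l d : (i : Fin (r + 1)) → Fin (n i + 1) → ℤ)
    (i : Fin (r + 1)) (j j' : Fin (n i + 1)) : ℤ :=
  l i j * d i j' - l i j' * d i j

open Finset

/-- The cofactor of the entry of `u` in column `t` of a square matrix whose columns are
`e_{i_s}` plus multiples of `u`. -/
def uCofactor (r : ℕ) (i : Fin (r + 1) → Fin (r + 1)) (t : Fin (r + 1)) : ℤ :=
  (-1) ^ (r + (t : ℕ)) *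
    (Matrix.of fun k s : Fin r => eVec r (i (t.succAbove s)) k.castSucc).det

lemma uCofactor_congr {r : ℕ} {i i' : Fin (r + 1) → Fin (r + 1)} {t : Fin (r + 1)}
    (h : ∀ s, s ≠ t → i s = i' s) : uCofactor r i t = uCofactor r i' t := by
  have : ∀ s, i (t.succAbove s) = i' (t.succAbove s) := fun s => h _ (Fin.succAbove_ne t s)
  simp only [uCofactor, this]

lemma det_eq_sum_uCofactor (r : ℕ) (i : Fin (r + 1) → Fin (r + 1)) (x y : Fin (r + 1) → ℤ) :
    (Matrix.of fun k t : Fin (r + 1) => x t * eVec r (i t) k + y t * uVec r k).det =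
      ∑ t, y t * (∏ s ∈ univ.erase t, x s) * uCofactor r i t := by
  rw [Matrix.det_succ_row _ (Fin.last r)]
  refine sum_congr rfl fun t _ => ?_
  have hlast : eVec r (i t) (Fin.last r) = 0 := by
    have := (i t).isLt
    simp only [eVec, Fin.val_last]
    split_ifs <;> first | rfl | omega
  have hu : uVec r (Fin.last r) = 1 := by simp [uVec]
  have hprod : ∏ s ∈ univ.erase t, x s = ∏ s, x (t.succAbove s) := by
    rw [← compl_singleton, ← Fin.image_succAbove_univ,
      prod_image fun _ _ _ _ h => Fin.succAbove_right_injective h]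
  have hsub : (Matrix.of fun k t : Fin (r + 1) =>
        x t * eVec r (i t) k + y t * uVec r k).submatrix (Fin.last r).succAbove t.succAbove =
      Matrix.of fun k s => x (t.succAbove s) *
        (Matrix.of fun k s : Fin r => eVec r (i (t.succAbove s)) k.castSucc) k s := by
    ext k s
    have : uVec r k.castSucc = 0 := by simp [uVec, k.isLt.ne]
    simp [this]
  rw [hsub, Matrix.det_mul_row, hprod]
  simp only [Matrix.of_apply, hlast, hu, uCofactor, Fin.val_last]
  ring

lemma sum_mul_uCofactor (r : ℕ) (i : Fin (r + 1) → Fin (r + 1)) (y : Fin (r + 1) → ℤ) :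
    ∑ t, y t * uCofactor r i t =
      (Matrix.of fun k t : Fin (r + 1) => eVec r (i t) k + y t * uVec r k).det := by
  simpa using (det_eq_sum_uCofactor r i (fun _ => 1) y).symm

lemma uCofactor_eq_zero {r : ℕ} {i : Fin (r + 1) → Fin (r + 1)} {a b t : Fin (r + 1)}
    (hab : a ≠ b) (h : i a = i b) (hta : a ≠ t) (htb : b ≠ t) : uCofactor r i t = 0 := by
  have := sum_mul_uCofactor r i (Pi.single t 1)
  rw [Matrix.det_zero_of_column_eq hab (by intro k; simp [h, hta, htb])] at this
  simpa [Pi.single_apply] using this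

lemma uCofactor_add_eq_zero {r : ℕ} {i : Fin (r + 1) → Fin (r + 1)} {a b : Fin (r + 1)}
    (hab : a ≠ b) (h : i a = i b) : uCofactor r i a + uCofactor r i b = 0 := by
  have := sum_mul_uCofactor r i (Pi.single a 1 + Pi.single b 1)
  rw [Matrix.det_zero_of_column_eq hab (by intro k; simp [h, hab, hab.symm])] at this
  simpa [Pi.single_apply, add_mul, sum_add_distrib] using this

lemma sum_eVec (r : ℕ) (k : Fin (r + 1)) : ∑ i, eVec r i k = 0 := by
  rw [Fin.sum_univ_succ]
  refine Fin.lastCases ?_ (fun k => ?_) k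
  · simp only [eVec, Fin.val_last, Fin.val_succ]
    simp only [Fin.val_zero, if_true, zero_add, Nat.add_right_cancel_iff, Nat.succ_ne_zero,
      if_false]
    exact sum_eq_zero fun s _ => if_neg s.isLt.ne'
  · simp [eVec, k.isLt.ne, Fin.val_inj]

lemma uCofactor_eq_of_injective {r : ℕ} {i : Fin (r + 1) → Fin (r + 1)}
    (hi : Function.Injective i) (a b : Fin (r + 1)) : uCofactor r i a = uCofactor r i b := by
  have := sum_mul_uCofactor r i (Pi.single a 1 - Pi.single b 1)
  rw [Matrix.exists_mulVec_eq_zero_iff.mp ⟨fun _ => 1, ?_, ?_⟩] at this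
  · simp only [Pi.sub_apply, Pi.single_apply, sub_mul, ite_mul, one_mul, zero_mul,
      sum_sub_distrib, sum_ite_eq', mem_univ, if_true] at this
    exact sub_eq_zero.mp this
  · exact fun h => one_ne_zero (congrFun h 0)
  · ext k
    have := (Equiv.ofBijective i (Finite.injective_iff_bijective.mp hi)).sum_comp
      (fun t => eVec r t k)
    simp only [Equiv.ofBijective_apply, sum_eVec] at this
    simp [Matrix.mulVec, dotProduct, sum_add_distrib, this, ← sum_mul, Pi.single_apply]

lemma natAbs_uCofactor_id (r : ℕ) (t : Fin (r + 1)) : (uCofactor r id t).natAbs = 1 := by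
  rw [uCofactor_eq_of_injective Function.injective_id t 0]
  have : (Matrix.of fun k s : Fin r => eVec r (id ((0 : Fin (r + 1)).succAbove s)) k.castSucc) =
      1 := by
    ext k s
    simp [eVec, Matrix.one_apply, Fin.val_inj]
  rw [uCofactor, this]
  simp [Int.natAbs_pow]

lemma det_of_injective {r : ℕ} {i : Fin (r + 1) → Fin (r + 1)} (hi : Function.Injective i)
    (x y : Fin (r + 1) → ℤ) (a : Fin (r + 1)) :
    (Matrix.of fun k t : Fin (r + 1) => x t * eVec r (i t) k + y t * uVec r k).det =
      uCofactor r i a * ∑ t, y t * ∏ s ∈ univ.erase t, x s := by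
  rw [det_eq_sum_uCofactor, mul_sum]
  refine sum_congr rfl fun t _ => ?_
  rw [uCofactor_eq_of_injective hi t a, mul_comm]

lemma det_of_eq {r : ℕ} {i : Fin (r + 1) → Fin (r + 1)} {a b : Fin (r + 1)} (hab : a ≠ b)
    (h : i a = i b) (x y : Fin (r + 1) → ℤ) :
    (Matrix.of fun k t : Fin (r + 1) => x t * eVec r (i t) k + y t * uVec r k).det =
      uCofactor r i a * ((x b * y a - x a * y b) * ∏ s ∈ (univ.erase b).erase a, x s) := by
  have hz : ∀ t ∈ univ, t ∉ ({a, b} : Finset (Fin (r + 1))) →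
      y t * (∏ s ∈ univ.erase t, x s) * uCofactor r i t = 0 := by
    intro t _ ht
    simp only [mem_insert, mem_singleton, not_or] at ht
    rw [uCofactor_eq_zero hab h (Ne.symm ht.1) (Ne.symm ht.2), mul_zero]
  rw [det_eq_sum_uCofactor, ← sum_subset (subset_univ _) hz, sum_pair hab,
    ← mul_prod_erase (univ.erase a) x (mem_erase.mpr ⟨hab.symm, mem_univ b⟩),
    ← mul_prod_erase (univ.erase b) x (mem_erase.mpr ⟨hab, mem_univ a⟩), erase_right_comm]
  linear_combination
    (x a * y b * ∏ s ∈ (univ.erase b).erase a, x s) * uCofactor_add_eq_zero hab h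

section Divisibility

variable {r : ℕ} {n : Fin (r + 1) → ℕ} {l d : (i : Fin (r + 1)) → Fin (n i + 1) → ℤ} {G : ℤ}

lemma muP_update (q : (i : Fin (r + 1)) → Fin (n i + 1)) (i : Fin (r + 1)) (j : Fin (n i + 1)) :
    muP r n l d (Function.update q i j) =
      d i j * ∏ k ∈ univ.erase i, l k (q k) +
        l i j * ∑ k ∈ univ.erase i, d k (q k) * ∏ s ∈ (univ.erase i).erase k, l s (q s) := by
  rw [muP, ← add_sum_erase _ _ (mem_univ i), mul_sum]
  congr 1
  · rw [Function.update_self]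
    congr 1
    refine prod_congr rfl fun k hk => ?_
    rw [Function.update_of_ne (ne_of_mem_erase hk)]
  · refine sum_congr rfl fun k hk => ?_
    have hki := ne_of_mem_erase hk
    rw [Function.update_of_ne hki,
      ← mul_prod_erase (univ.erase k) _ (mem_erase.mpr ⟨hki.symm, mem_univ i⟩),
      Function.update_self, erase_right_comm,
      prod_congr rfl fun s hs => by
        rw [Function.update_of_ne (ne_of_mem_erase (mem_of_mem_erase hs))]]
    ring

lemma dvd_of_dvd_mul_of_gcd_eq_one {a b x : ℤ} (h : Int.gcd a b = 1) (ha : G ∣ a * x)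
    (hb : G ∣ b * x) : G ∣ x := by
  have hx : x = Int.gcdA a b * (a * x) + Int.gcdB a b * (b * x) := by
    have := Int.gcd_eq_gcd_ab a b
    rw [h] at this
    linear_combination x * this
  rw [hx]
  exact dvd_add (ha.mul_left _) (hb.mul_left _)

/-- Divisibility of all minors involving two columns of one block. -/
lemma dvd_nuP_mul_prod (hcop : ∀ i j, Int.gcd (l i j) (d i j) = 1)
    (hν : ∀ (i₀ i₁ : Fin (r + 1)) (q : (i : Fin (r + 1)) → Fin (n i + 1)), i₀ ≠ i₁ →
      G ∣ nuP r n l d i₀ (q i₀) (Fin.last (n i₀)) * ∏ i ∈ (univ.erase i₀).erase i₁, l i (q i))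
    {i₀ i₁ : Fin (r + 1)} (h : i₀ ≠ i₁) (q : (i : Fin (r + 1)) → Fin (n i + 1))
    (j j' : Fin (n i₀ + 1)) :
    G ∣ nuP r n l d i₀ j j' * ∏ i ∈ (univ.erase i₀).erase i₁, l i (q i) := by
  have key (j) :
      G ∣ nuP r n l d i₀ j (Fin.last (n i₀)) * ∏ i ∈ (univ.erase i₀).erase i₁, l i (q i) := by
    have := hν i₀ i₁ (Function.update q i₀ j) h
    rwa [Function.update_self, prod_congr rfl fun s hs => by
      rw [Function.update_of_ne (ne_of_mem_erase (mem_of_mem_erase hs))]] at this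
  refine dvd_of_dvd_mul_of_gcd_eq_one (hcop i₀ (Fin.last (n i₀))) ?_ ?_
  · refine (dvd_sub ((key j).mul_left (l i₀ j')) ((key j').mul_left (l i₀ j))).trans (Eq.dvd ?_)
    simp only [nuP]
    ring
  · refine (dvd_sub ((key j).mul_left (d i₀ j')) ((key j').mul_left (d i₀ j))).trans (Eq.dvd ?_)
    simp only [nuP]
    ring

lemma dvd_muP_update (hr : 1 ≤ r) (hcop : ∀ i j, Int.gcd (l i j) (d i j) = 1)
    (hν : ∀ (i₀ i₁ : Fin (r + 1)) (q : (i : Fin (r + 1)) → Fin (n i + 1))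
      (j j' : Fin (n i₀ + 1)), i₀ ≠ i₁ →
      G ∣ nuP r n l d i₀ j j' * ∏ i ∈ (univ.erase i₀).erase i₁, l i (q i))
    (q : (i : Fin (r + 1)) → Fin (n i + 1)) (i : Fin (r + 1)) (j : Fin (n i + 1))
    (hq : G ∣ muP r n l d q) : G ∣ muP r n l d (Function.update q i j) := by
  have : Nontrivial (Fin (r + 1)) := Fin.nontrivial_iff_two_le.mpr (by omega)
  obtain ⟨i₁, hi₁⟩ := exists_ne i
  have hΛ : G ∣ nuP r n l d i (q i) j * ∏ k ∈ univ.erase i, l k (q k) := by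
    rw [← mul_prod_erase _ _ (mem_erase.mpr ⟨hi₁, mem_univ i₁⟩), mul_left_comm]
    exact (hν i i₁ q _ _ hi₁.symm).mul_left _
  have hD : G ∣ nuP r n l d i (q i) j *
      ∑ k ∈ univ.erase i, d k (q k) * ∏ s ∈ (univ.erase i).erase k, l s (q s) := by
    rw [mul_sum]
    refine dvd_sum fun k hk => ?_
    rw [mul_left_comm]
    exact (hν i k q _ _ (ne_of_mem_erase hk).symm).mul_left _
  have hself := muP_update (l := l) (d := d) q i (q i)
  rw [Function.update_eq_self] at hself
  have hupd := muP_update (l := l) (d := d) q i j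
  simp only [nuP] at hΛ hD
  refine dvd_of_dvd_mul_of_gcd_eq_one (hcop i (q i)) ?_ ?_
  · refine (dvd_add (hq.mul_left (l i j)) hΛ).trans (Eq.dvd ?_)
    rw [hself, hupd]
    ring
  · refine (dvd_sub (hq.mul_left (d i j)) hD).trans (Eq.dvd ?_)
    rw [hself, hupd]
    ring

lemma dvd_muP (hr : 1 ≤ r) (hcop : ∀ i j, Int.gcd (l i j) (d i j) = 1)
    (hν : ∀ (i₀ i₁ : Fin (r + 1)) (q : (i : Fin (r + 1)) → Fin (n i + 1))
      (j j' : Fin (n i₀ + 1)), i₀ ≠ i₁ →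
      G ∣ nuP r n l d i₀ j j' * ∏ i ∈ (univ.erase i₀).erase i₁, l i (q i))
    {p : (i : Fin (r + 1)) → Fin (n i + 1)} (hp : G ∣ muP r n l d p)
    (q : (i : Fin (r + 1)) → Fin (n i + 1)) : G ∣ muP r n l d q := by
  have (S : Finset (Fin (r + 1))) : G ∣ muP r n l d (S.piecewise q p) := by
    induction S using Finset.induction_on with
    | empty => simpa using hp
    | insert a S _ ih =>
      rw [piecewise_insert]
      exact dvd_muP_update hr hcop hν _ _ _ ih
  simpa using this univ

end Divisibility

lemma exists_section {ι : Type*} {β : ι → Type*} [∀ i, Nonempty (β i)] {κ : Type*}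
    (A : κ → (i : ι) × β i) (S : Set κ) (hA : Set.InjOn (fun s => (A s).1) S) :
    ∃ q : (i : ι) → β i, ∀ s ∈ S, A s = ⟨(A s).1, q (A s).1⟩ := by
  have (i : ι) : ∃ b : β i, ∀ s ∈ S, (A s).1 = i → A s = ⟨i, b⟩ := by
    by_cases h : ∃ s ∈ S, (A s).1 = i
    · obtain ⟨s, hs, rfl⟩ := h
      refine ⟨(A s).2, fun t ht hts => ?_⟩
      rw [hA ht hs hts]
    · exact ⟨Classical.arbitrary _, fun s hs hsi => (h ⟨s, hs, hsi⟩).elim⟩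
  choose q hq using this
  exact ⟨q, fun s hs => hq _ s hs rfl⟩

lemma dvd_det_colV {r : ℕ} (hr : 1 ≤ r) {n : Fin (r + 1) → ℕ}
    {l d : (i : Fin (r + 1)) → Fin (n i + 1) → ℤ} {G : ℤ}
    (hcop : ∀ i j, Int.gcd (l i j) (d i j) = 1)
    (hμ : G ∣ muP r n l d fun i => Fin.last (n i))
    (hν : ∀ (i₀ i₁ : Fin (r + 1)) (q : (i : Fin (r + 1)) → Fin (n i + 1)), i₀ ≠ i₁ →
      G ∣ nuP r n l d i₀ (q i₀) (Fin.last (n i₀)) * ∏ i ∈ (univ.erase i₀).erase i₁, l i (q i))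
    (A : Fin (r + 1) → (i : Fin (r + 1)) × Fin (n i + 1)) :
    G ∣ (Matrix.of fun k t : Fin (r + 1) => colV r n l d (A t).1 (A t).2 k).det := by
  have hν' {i₀ i₁ : Fin (r + 1)} (q : (i : Fin (r + 1)) → Fin (n i + 1))
    (j j' : Fin (n i₀ + 1)) (h : i₀ ≠ i₁) := dvd_nuP_mul_prod hcop hν h q j j'
  simp only [colV]
  by_cases hinj : Function.Injective fun t => (A t).1
  · obtain ⟨q, hq⟩ := exists_section A Set.univ hinj.injOn
    rw [det_of_injective hinj _ _ 0]
    refine Dvd.dvd.mul_left ?_ _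
    have hx (t) : l (A t).1 (A t).2 = l (A t).1 (q (A t).1) := by rw [hq t trivial]
    have hy (t) : d (A t).1 (A t).2 = d (A t).1 (q (A t).1) := by rw [hq t trivial]
    simp only [hx, hy]
    refine (dvd_muP hr hcop (fun _ _ => hν') hμ q).trans (Eq.dvd ?_)
    rw [muP, ← (Equiv.ofBijective _ (Finite.injective_iff_bijective.mp hinj)).sum_comp]
    refine sum_congr rfl fun t _ => ?_
    have himage : univ.erase (A t).1 = (univ.erase t).image fun t => (A t).1 := by
      rw [image_erase hinj,
        image_univ_of_surjective (Finite.injective_iff_surjective.mp hinj)]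
    simp only [Equiv.ofBijective_apply]
    rw [himage, prod_image hinj.injOn]
    rfl
  · obtain ⟨a, b, hab', hab⟩ : ∃ a b, (A a).1 = (A b).1 ∧ a ≠ b := by
      simpa [Function.Injective] using hinj
    rw [det_of_eq (i := fun t => (A t).1) hab hab']
    by_cases hinj' : Set.InjOn (fun t => (A t).1) {a}ᶜ
    · refine Dvd.dvd.mul_left ?_ _
      obtain ⟨q, hq⟩ := exists_section A {a}ᶜ hinj'
      obtain ⟨i₁, hi₁⟩ : ∃ i₁, ∀ t, (A t).1 ≠ i₁ := by
        have := mt Finite.injective_iff_surjective.mpr hinj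
        simpa [Function.Surjective] using this
      obtain ⟨σ, hσa, hσs⟩ : ∃ σ : Fin (r + 1) → Fin (r + 1),
          σ a = i₁ ∧ ∀ s, s ≠ a → σ s = (A s).1 :=
        ⟨Function.update (fun t => (A t).1) a i₁, by simp, fun s hs => by simp [hs]⟩
      have hσ : Function.Injective σ := by
        intro s t hst
        by_cases hs : s = a <;> by_cases ht : t = a
        · rw [hs, ht]
        · rw [hs, hσa, hσs t ht] at hst
          exact (hi₁ t hst.symm).elim
        · rw [ht, hσa, hσs s hs] at hst
          exact (hi₁ s hst).elim
        · rw [hσs s hs, hσs t ht] at hst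
          exact hinj' hs ht hst
      have himage : (univ.erase (A b).1).erase i₁ = ((univ.erase b).erase a).image σ := by
        rw [image_erase hσ, image_erase hσ,
          image_univ_of_surjective (Finite.injective_iff_surjective.mp hσ), hσa,
          hσs b hab.symm]
      have hprod : ∏ s ∈ (univ.erase b).erase a, l (A s).1 (A s).2 =
          ∏ i ∈ (univ.erase (A b).1).erase i₁, l i (q i) := by
        rw [himage, prod_image hσ.injOn]
        refine prod_congr rfl fun s hs => ?_
        have hsa := ne_of_mem_erase hs
        rw [hσs s hsa, hq s hsa]
      rw [hprod]
      have hne := hi₁ b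
      generalize A b = B at *
      generalize A a = C at *
      obtain ⟨i₀, j⟩ := B
      obtain ⟨i₀', j'⟩ := C
      obtain rfl : i₀' = i₀ := hab'
      exact hν' q j j' hne
    · obtain ⟨s, hs, t, ht, hst, hne⟩ : ∃ s, s ≠ a ∧ ∃ t, t ≠ a ∧ (A s).1 = (A t).1 ∧ s ≠ t := by
        simpa [Set.InjOn] using hinj'
      rw [uCofactor_eq_zero (i := fun t => (A t).1) hne hst hs ht, zero_mul]
      exact dvd_zero _

lemma natAbs_det_colV_block (r : ℕ) (n : Fin (r + 1) → ℕ)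
    (l d : (i : Fin (r + 1)) → Fin (n i + 1) → ℤ) (q : (i : Fin (r + 1)) → Fin (n i + 1)) :
    (Matrix.of fun k t : Fin (r + 1) => colV r n l d t (q t) k).det.natAbs =
      (muP r n l d q).natAbs := by
  simp only [colV]
  rw [det_of_injective (i := fun t => t) Function.injective_id _ _ 0, Int.natAbs_mul,
    show uCofactor r (fun t => t) 0 = uCofactor r id 0 from rfl, natAbs_uCofactor_id, one_mul, muP]

lemma natAbs_det_colV_update (r : ℕ) (n : Fin (r + 1) → ℕ)
    (l d : (i : Fin (r + 1)) → Fin (n i + 1) → ℤ) (q : (i : Fin (r + 1)) → Fin (n i + 1))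
    {i₀ i₁ : Fin (r + 1)} (h : i₀ ≠ i₁) (j : Fin (n i₀ + 1))
    (A : Fin (r + 1) → (i : Fin (r + 1)) × Fin (n i + 1))
    (hA : A = Function.update (fun t => ⟨t, q t⟩) i₁ ⟨i₀, j⟩) :
    (Matrix.of fun k t : Fin (r + 1) => colV r n l d (A t).1 (A t).2 k).det.natAbs =
      (nuP r n l d i₀ (q i₀) j * ∏ i ∈ (univ.erase i₀).erase i₁, l i (q i)).natAbs := by
  have h₁ : A i₁ = ⟨i₀, j⟩ := by simp [hA]
  have hne {t} (ht : t ≠ i₁) : A t = ⟨t, q t⟩ := by simp [hA, ht]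
  simp only [colV]
  rw [det_of_eq (i := fun t => (A t).1) h.symm (by rw [h₁, hne h]), Int.natAbs_mul,
    uCofactor_congr (i' := id) fun s hs => by rw [hne hs]; rfl, natAbs_uCofactor_id, one_mul,
    h₁, hne h, prod_congr rfl fun s hs => by rw [hne (ne_of_mem_erase hs)]]
  rfl

/-- for a defining matrix `P` of type (ee), `gcd(M(P)) = gcd(M'(P))`, where
`M(P)` is the set of absolute values of maximal minors of `P` (realized as the gcd of
`|det(P_A)|` over all choices `A` of `r+1` columns of `P`) and
`M'(P) = {|μ̂|} ∪ {|ν̂(i₀, j_{i₀})|·Π_{i ∉ {i₀,i₁}} l_{i j_i}}` with `i₀ ≠ i₁`. -/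
theorem stmt7 (r : ℕ) (hr : 1 ≤ r) (n : Fin (r + 1) → ℕ)
    (l d : (i : Fin (r + 1)) → Fin (n i + 1) → ℤ)
    (hl : ∀ i j, 1 ≤ l i j)
    (hcop : ∀ i j, Int.gcd (l i j) (d i j) = 1)
    (hslope : ∀ (i : Fin (r + 1)) (j j' : Fin (n i + 1)), j < j' →
      (d i j' : ℚ) / (l i j' : ℚ) < (d i j : ℚ) / (l i j : ℚ))
    (hcone : ∀ x : Fin (r + 1) → ℚ,
      ∃ c : ((i : Fin (r + 1)) × Fin (n i + 1)) → ℚ,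
        (∀ a, 0 ≤ c a) ∧ ∀ k, x k = ∑ a, c a * ((colV r n l d a.1 a.2 k : ℤ) : ℚ)) :
    Finset.univ.gcd
      (fun A : Fin (r + 1) → ((i : Fin (r + 1)) × Fin (n i + 1)) =>
        (Matrix.of (fun k t : Fin (r + 1) => colV r n l d (A t).1 (A t).2 k)).det.natAbs)
      =
    Nat.gcd ((muP r n l d (fun i => Fin.last (n i))).natAbs)
      ((Finset.univ.filter
          (fun p : Fin (r + 1) × Fin (r + 1) × ((i : Fin (r + 1)) → Fin (n i + 1)) =>
            p.1 ≠ p.2.1)).gcd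
        (fun p =>
          (nuP r n l d p.1 (p.2.2 p.1) (Fin.last (n p.1)) *
            ∏ i ∈ (Finset.univ.erase p.1).erase p.2.1, l i (p.2.2 i)).natAbs)) := by
  apply Nat.dvd_antisymm
  · refine Nat.dvd_gcd ?_ (dvd_gcd fun p hp => ?_)
    · rw [← natAbs_det_colV_block]
      exact gcd_dvd (f := fun A : Fin (r + 1) → ((i : Fin (r + 1)) × Fin (n i + 1)) =>
        (Matrix.of (fun k t : Fin (r + 1) => colV r n l d (A t).1 (A t).2 k)).det.natAbs)
        (mem_univ fun t => ⟨t, Fin.last (n t)⟩)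
    · rw [← natAbs_det_colV_update r n l d p.2.2 (mem_filter.mp hp).2 _ _ rfl]
      exact gcd_dvd (f := fun A : Fin (r + 1) → ((i : Fin (r + 1)) × Fin (n i + 1)) =>
        (Matrix.of (fun k t : Fin (r + 1) => colV r n l d (A t).1 (A t).2 k)).det.natAbs)
        (mem_univ _)
  · refine dvd_gcd fun A _ => Int.natCast_dvd.mp (dvd_det_colV hr hcop ?_ ?_ A)
    · exact Int.natCast_dvd.mpr (Nat.gcd_dvd_left _ _)
    · intro i₀ i₁ q h
      refine Int.natCast_dvd.mpr ((Nat.gcd_dvd_right _ _).trans ?_)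
      exact gcd_dvd (s := univ.filter
          (fun p : Fin (r + 1) × Fin (r + 1) × ((i : Fin (r + 1)) → Fin (n i + 1)) =>
            p.1 ≠ p.2.1)) (f := fun p =>
          (nuP r n l d p.1 (p.2.2 p.1) (Fin.last (n p.1)) *
            ∏ i ∈ (Finset.univ.erase p.1).erase p.2.1, l i (p.2.2 i)).natAbs)
        (b := (i₀, i₁, q)) (mem_filter.mpr ⟨mem_univ _, h⟩)
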